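/- The cascade ℬ is a maximal set of pairwise strongly orthogonal roots in Δ₊: any two distinct elements of ℬ are strongly orthogonal, and if S ⊆ Δ₊ is a set of pairwise strongly orthogonal roots with ℬ ⊆ S, then S = ℬ. -/

import Mathlib

open scoped InnerProductSpace BigOperators

structure RootSystemData (V : Type*) [NormedAddCommGroup V] [InnerProductSpace ℝ V] where
  Δ : Set V
  finite : Δ.Finite
  span_top : Submodule.span ℝ Δ = ⊤
  zero_not_mem : (0 : V) ∉ Δ
  neg_mem : ∀ α ∈ Δ, -α ∈ Δ
  reduced : ∀ α ∈ Δ, ∀ t : ℝ, t • α ∈ Δ → t = 1 ∨ t = -1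
  crystal : ∀ α ∈ Δ, ∀ β ∈ Δ, ∃ n : ℤ, 2 * ⟪α, β⟫_ℝ = (n : ℝ) * ⟪β, β⟫_ℝ
  reflect_mem : ∀ α ∈ Δ, ∀ β ∈ Δ, α - (2 * ⟪α, β⟫_ℝ / ⟪β, β⟫_ℝ) • β ∈ Δ
  Pos : Set V
  pos_subset : Pos ⊆ Δ
  mem_or_neg : ∀ α ∈ Δ, α ∈ Pos ∨ -α ∈ Pos
  not_neg_mem : ∀ α ∈ Pos, -α ∉ Pos
  pos_add : ∀ α ∈ Pos, ∀ β ∈ Pos, α + β ∈ Δ → α + β ∈ Pos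

namespace RootSystemData

variable {V : Type*} [NormedAddCommGroup V] [InnerProductSpace ℝ V] (R : RootSystemData V)

/-- The set of simple roots: indecomposable positive roots. -/
def Simple : Set V := {α ∈ R.Pos | ¬ ∃ β ∈ R.Pos, ∃ γ ∈ R.Pos, α = β + γ}

/-- The support `Π(φ)` of a positive root: the simple roots needed to express `φ`. -/
def support (φ : V) : Set V := {α ∈ R.Simple | φ ∉ Submodule.span ℝ (R.Simple \ {α})}

/-- The root subsystem `Δ(φ)`: all roots lying in the span of the support of `φ`. -/
def sub (φ : V) : Set V := {ψ ∈ R.Δ | ψ ∈ Submodule.span ℝ (R.support φ)}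

/-- The positive roots `Δ(φ)₊` of the subsystem `Δ(φ)`. -/
def posSub (φ : V) : Set V := R.sub φ ∩ R.Pos

/-- `x` is a nonnegative integer combination of positive roots. -/
def NonnegComb (x : V) : Prop :=
  ∃ c : V →₀ ℕ, ↑c.support ⊆ R.Pos ∧ x = c.sum fun α n => (n : ℝ) • α

/-- `β` is the highest root of the subset `S`. -/
def IsHighest (S : Set V) (β : V) : Prop :=
  β ∈ S ∧ β ∈ R.Pos ∧ ∀ ψ ∈ S, R.NonnegComb (β - ψ)

/-- `β` is locally high: it is the highest root of `Δ(β)`. -/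
def LocallyHigh (β : V) : Prop := β ∈ R.Pos ∧ R.IsHighest (R.sub β) β

/-- `E(β) = {φ ∈ Δ(β) : (φ,β) > 0}`. -/
def E (β : V) : Set V := {φ ∈ R.sub β | 0 < ⟪φ, β⟫_ℝ}

/-- `Δ(β)° = {φ ∈ Δ(β) : (φ,β) = 0}`. -/
def orth (β : V) : Set V := {φ ∈ R.sub β | ⟪φ, β⟫_ℝ = 0}

/-- Strong orthogonality of two roots. -/
def StronglyOrth (φ ψ : V) : Prop := φ + ψ ∉ R.Δ ∧ φ - ψ ∉ R.Δ


/-- Half the sum of the positive roots of `Δ(β)`. -/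
noncomputable def rho (β : V) : V := (2⁻¹ : ℝ) • ∑ᶠ φ ∈ R.posSub β, φ

/-- The dual Coxeter number of `Δ(β)`, `⟨ρ_β, β^∨⟩ + 1`. -/
noncomputable def dualCoxeter (β : V) : ℝ := 2 * ⟪R.rho β, β⟫_ℝ / ⟪β, β⟫_ℝ + 1

end RootSystemData

/-- A finite set of vectors is irreducible if it is nonempty and admits no splitting into
two nonempty mutually orthogonal pieces. -/
def IsIrred {V : Type*} [NormedAddCommGroup V] [InnerProductSpace ℝ V] (S : Set V) : Prop :=
  S.Nonempty ∧ ¬ ∃ A B : Set V, A ∪ B = S ∧ A ∩ B = ∅ ∧ A.Nonempty ∧ B.Nonempty ∧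
    ∀ a ∈ A, ∀ b ∈ B, ⟪a, b⟫_ℝ = 0

/-- `C` is an irreducible component of `S`. -/
def IsComponent {V : Type*} [NormedAddCommGroup V] [InnerProductSpace ℝ V]
    (S C : Set V) : Prop :=
  C ⊆ S ∧ IsIrred C ∧ ∀ a ∈ C, ∀ b ∈ S \ C, ⟪a, b⟫_ℝ = 0

/-- The reflection `s_β` in the (co)vector `β`. -/
noncomputable def reflectRoot {V : Type*} [NormedAddCommGroup V] [InnerProductSpace ℝ V]
    (β v : V) : V := v - (2 * ⟪v, β⟫_ℝ / ⟪β, β⟫_ℝ) • β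

namespace RootSystemData

variable {V : Type*} [NormedAddCommGroup V] [InnerProductSpace ℝ V] (R : RootSystemData V)

/-- A chain cascade: a nonempty list whose head is the highest root of an irreducible
component of `Δ`, and each subsequent entry is the highest root of an irreducible component
of `Δ(previous)°`. -/
def IsChainCascade (l : List V) : Prop :=
  l ≠ [] ∧
  (∀ b ∈ l.head?, ∃ C, IsComponent R.Δ C ∧ R.IsHighest C b) ∧
  l.Chain' fun γ δ => ∃ C, IsComponent (R.orth γ) C ∧ R.IsHighest C δ

/-- The cascade `ℬ` of roots: all positive roots belonging to some chain cascade. -/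
def cascade : Set V := {β | ∃ l, R.IsChainCascade l ∧ β ∈ l}

/-- `l` is the chain cascade `C(φ)` associated to the positive root `φ`. -/
def IsCascadeChainOf (φ : V) (l : List V) : Prop :=
  R.IsChainCascade l ∧ (∀ β ∈ l, φ ∈ R.sub β) ∧
  (∀ β ∈ l.dropLast, ⟪φ, β⟫_ℝ = 0) ∧ ∀ β ∈ l.getLast?, 0 < ⟪φ, β⟫_ℝ

end RootSystemData

namespace RootSystemData

variable {V : Type*} [NormedAddCommGroup V] [InnerProductSpace ℝ V] (R : RootSystemData V)

lemma ne_zero_of_mem {α : V} (h : α ∈ R.Δ) : α ≠ 0 := fun h0 => R.zero_not_mem (h0 ▸ h)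

lemma inner_self_pos_of_mem {α : V} (h : α ∈ R.Δ) : 0 < ⟪α, α⟫_ℝ :=
  real_inner_self_pos.2 (R.ne_zero_of_mem h)

/-- If two distinct roots have positive inner product, their difference is a root. -/
lemma sub_mem_of_inner_pos {α β : V} (hα : α ∈ R.Δ) (hβ : β ∈ R.Δ) (hne : α ≠ β)
    (h : 0 < ⟪α, β⟫_ℝ) : α - β ∈ R.Δ := by
  obtain ⟨n, hn⟩ := R.crystal α hα β hβ
  obtain ⟨m, hm⟩ := R.crystal β hβ α hα
  have ha := R.inner_self_pos_of_mem hα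
  have hb := R.inner_self_pos_of_mem hβ
  have hcomm := real_inner_comm α β
  rw [hcomm] at hm
  have hn0 : (0 : ℤ) < n := by
    have : (0 : ℝ) < n := pos_of_mul_pos_left (by rw [← hn]; linarith) hb.le
    exact_mod_cast this
  have hm0 : (0 : ℤ) < m := by
    have : (0 : ℝ) < m := pos_of_mul_pos_left (by rw [← hm]; linarith) ha.le
    exact_mod_cast this
  have h1 : n = 1 → α - β ∈ R.Δ := by
    rintro rfl
    have := R.reflect_mem α hα β hβ
    rwa [hn, mul_div_cancel_right₀ _ hb.ne', Int.cast_one, one_smul] at this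
  have h2 : m = 1 → α - β ∈ R.Δ := by
    rintro rfl
    have := R.reflect_mem β hβ α hα
    rw [hcomm, hm, mul_div_cancel_right₀ _ ha.ne', Int.cast_one, one_smul] at this
    rw [← neg_sub]
    exact R.neg_mem _ this
  by_contra hcon
  have hn2 : (2 : ℤ) ≤ n := by have : n ≠ 1 := fun e => hcon (h1 e); omega
  have hm2 : (2 : ℤ) ≤ m := by have : m ≠ 1 := fun e => hcon (h2 e); omega
  have hn2' : (2 : ℝ) ≤ n := by exact_mod_cast hn2
  have hm2' : (2 : ℝ) ≤ m := by exact_mod_cast hm2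
  have hle : ⟪α - β, α - β⟫_ℝ ≤ 0 := by
    rw [inner_sub_left, inner_sub_right, inner_sub_right, hcomm]
    nlinarith
  exact hne (sub_eq_zero.1 (real_inner_self_nonpos.1 hle))

/-- If two non-opposite roots have negative inner product, their sum is a root. -/
lemma add_mem_of_inner_neg {α β : V} (hα : α ∈ R.Δ) (hβ : β ∈ R.Δ) (hne : α ≠ -β)
    (h : ⟪α, β⟫_ℝ < 0) : α + β ∈ R.Δ := by
  have := R.sub_mem_of_inner_pos hα (R.neg_mem β hβ) hne (by rw [inner_neg_right]; linarith)
  rwa [sub_neg_eq_add] at this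

/-- For orthogonal roots, the sum is a root if and only if the difference is. -/
lemma sub_mem_iff_add_mem {α β : V} (hβ : β ∈ R.Δ) (h : ⟪α, β⟫_ℝ = 0) :
    α - β ∈ R.Δ ↔ α + β ∈ R.Δ := by
  have hb := (R.inner_self_pos_of_mem hβ).ne'
  constructor <;> intro H
  · have := R.reflect_mem _ H β hβ
    rw [inner_sub_left, h] at this
    convert this using 1
    rw [show 2 * (0 - ⟪β, β⟫_ℝ) / ⟪β, β⟫_ℝ = -2 by field_simp; ring]
    module
  · have := R.reflect_mem _ H β hβ
    rw [inner_add_left, h] at this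
    convert this using 1
    rw [show 2 * (0 + ⟪β, β⟫_ℝ) / ⟪β, β⟫_ℝ = 2 by field_simp; ring]
    module

/-- Nonnegative integer combinations of positive roots. -/
def posCone : AddSubmonoid V := AddSubmonoid.closure R.Pos

lemma mem_posCone_of_pos {α : V} (h : α ∈ R.Pos) : α ∈ R.posCone :=
  AddSubmonoid.subset_closure h

lemma nonnegComb_iff_mem_posCone {x : V} : R.NonnegComb x ↔ x ∈ R.posCone := by
  constructor
  · rintro ⟨c, hc, rfl⟩
    refine AddSubmonoid.sum_mem _ fun α hα => ?_
    simp only [Nat.cast_smul_eq_nsmul]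
    exact AddSubmonoid.nsmul_mem _ (R.mem_posCone_of_pos (hc hα)) _
  · intro hx
    induction hx using AddSubmonoid.closure_induction with
    | mem x hx =>
      classical
      refine ⟨Finsupp.single x 1, fun y hy => ?_, by simp⟩
      obtain rfl : y = x := by
        simpa using Finsupp.support_single_subset hy
      exact hx
    | zero => exact ⟨0, by simp, by simp⟩
    | add x y _ _ hx hy =>
      classical
      obtain ⟨c, hc, rfl⟩ := hx
      obtain ⟨d, hd, rfl⟩ := hy
      refine ⟨c + d, fun z hz => ?_, ?_⟩
      · rcases Finset.mem_union.1 (Finsupp.support_add hz) with h | h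
        exacts [hc h, hd h]
      · rw [Finsupp.sum_add_index'] <;> intros <;> simp [add_smul]

lemma multiset_sum_ne_zero_of_pos (m : Multiset V) (hm : ∀ α ∈ m, α ∈ R.Pos) (h0 : m ≠ 0) :
    m.sum ≠ 0 := by
  induction hk : m.card using Nat.strong_induction_on generalizing m with
  | _ k ih =>
  intro hsum
  obtain ⟨a, t, rfl⟩ : ∃ a t, m = a ::ₘ t := by
    obtain ⟨a, ha⟩ := Multiset.exists_mem_of_ne_zero h0
    exact ⟨a, Multiset.exists_cons_of_mem ha⟩
  have ha : a ∈ R.Pos := hm a (by simp)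
  have haa := R.inner_self_pos_of_mem (R.pos_subset ha)
  rw [Multiset.sum_cons] at hsum
  obtain ⟨b, hb, hab⟩ : ∃ b ∈ t, ⟪a, b⟫_ℝ < 0 := by
    by_contra! hcon
    have key : ∀ s : Multiset V, (∀ b ∈ s, 0 ≤ ⟪a, b⟫_ℝ) → 0 ≤ ⟪a, s.sum⟫_ℝ := by
      intro s
      induction s using Multiset.induction with
      | empty => simp
      | cons b s ih =>
        intro h
        rw [Multiset.sum_cons, inner_add_right]
        exact add_nonneg (h b (by simp)) (ih fun c hc => h c (by simp [hc]))
    have := key t hcon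
    rw [eq_neg_of_add_eq_zero_right hsum, inner_neg_right] at this
    linarith
  obtain ⟨u, rfl⟩ := Multiset.exists_cons_of_mem hb
  have hb' : b ∈ R.Pos := hm b (by simp)
  have hne : a ≠ -b := fun e => R.not_neg_mem b hb' (e ▸ ha)
  have hadd := R.pos_add a ha b hb'
    (R.add_mem_of_inner_neg (R.pos_subset ha) (R.pos_subset hb') hne hab)
  refine ih _ ?_ ((a + b) ::ₘ u) ?_ (by simp) rfl ?_
  · simp only [Multiset.card_cons] at hk ⊢; omega
  · intro c hc
    rcases Multiset.mem_cons.1 hc with rfl | hc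
    exacts [hadd, hm c (by simp [hc])]
  · simpa [add_assoc] using hsum

/-- The cone of positive roots is pointed. -/
lemma eq_zero_of_mem_posCone {x : V} (hx : x ∈ R.posCone) (hx' : -x ∈ R.posCone) : x = 0 := by
  obtain ⟨s, hs, rfl⟩ := AddSubmonoid.exists_multiset_of_mem_closure hx
  obtain ⟨t, ht, hst⟩ := AddSubmonoid.exists_multiset_of_mem_closure hx'
  by_contra h
  refine R.multiset_sum_ne_zero_of_pos (s + t) ?_ ?_ (by simp [hst])
  · intro α hα
    rcases Multiset.mem_add.1 hα with hα | hα
    exacts [hs α hα, ht α hα]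
  · intro h0
    apply h
    rw [(add_eq_zero.1 h0).1, Multiset.sum_zero]

/-- The number of roots below `x`. -/
noncomputable def rank (x : V) : ℕ := {ψ ∈ R.Δ | x - ψ ∈ R.posCone}.ncard

lemma rank_lt_rank {x y : V} (hy : y ∈ R.Δ) (h : y - x ∈ R.posCone) (hne : x ≠ y) :
    R.rank x < R.rank y := by
  refine Set.ncard_lt_ncard ⟨fun ψ hψ => ⟨hψ.1, ?_⟩, fun hsub => ?_⟩
    (R.finite.subset (Set.sep_subset _ _))
  · simpa using add_mem h hψ.2
  · have := (hsub ⟨hy, by simp⟩ : y ∈ {ψ ∈ R.Δ | x - ψ ∈ R.posCone}).2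
    exact hne (sub_eq_zero.1 (R.eq_zero_of_mem_posCone this (by simpa using h)))

lemma ne_zero_of_pos {α : V} (h : α ∈ R.Pos) : α ≠ 0 := R.ne_zero_of_mem (R.pos_subset h)

/-- Every positive root is a sum of simple roots. -/
lemma pos_subset_closure_simple {φ : V} (hφ : φ ∈ R.Pos) :
    φ ∈ AddSubmonoid.closure R.Simple := by
  induction hk : R.rank φ using Nat.strong_induction_on generalizing φ with
  | _ k ih =>
  by_cases hs : φ ∈ R.Simple
  · exact AddSubmonoid.subset_closure hs
  · obtain ⟨γ, hγ, δ, hδ, rfl⟩ : ∃ β ∈ R.Pos, ∃ γ ∈ R.Pos, φ = β + γ := by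
      by_contra hcon
      exact hs ⟨hφ, hcon⟩
    have h1 : R.rank γ < k := hk ▸ R.rank_lt_rank (R.pos_subset hφ)
      (by simpa using R.mem_posCone_of_pos hδ) (by simpa using R.ne_zero_of_pos hδ)
    have h2 : R.rank δ < k := hk ▸ R.rank_lt_rank (R.pos_subset hφ)
      (by simpa using R.mem_posCone_of_pos hγ) (by simpa using R.ne_zero_of_pos hγ)
    exact add_mem (ih _ h1 hγ rfl) (ih _ h2 hδ rfl)

lemma closure_le_posCone {T : Set V} (hT : T ⊆ R.Simple) :
    AddSubmonoid.closure T ≤ R.posCone :=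
  AddSubmonoid.closure_mono fun _ h => (hT h).1

lemma inner_simple_nonpos {α β : V} (hα : α ∈ R.Simple) (hβ : β ∈ R.Simple) (hne : α ≠ β) :
    ⟪α, β⟫_ℝ ≤ 0 := by
  by_contra! h
  have hsub := R.sub_mem_of_inner_pos (R.pos_subset hα.1) (R.pos_subset hβ.1) hne h
  rcases R.mem_or_neg _ hsub with h' | h'
  · exact hα.2 ⟨β, hβ.1, _, h', by abel⟩
  · exact hβ.2 ⟨α, hα.1, _, h', by abel⟩

lemma inner_nonneg_of_mem_closure {T : Set V} {v x : V} (h : ∀ α ∈ T, 0 ≤ ⟪v, α⟫_ℝ)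
    (hx : x ∈ AddSubmonoid.closure T) : 0 ≤ ⟪v, x⟫_ℝ := by
  induction hx using AddSubmonoid.closure_induction with
  | mem x hx => exact h x hx
  | zero => simp
  | add x y _ _ hx hy => rw [inner_add_right]; exact add_nonneg hx hy

lemma inner_nonpos_of_mem_closure {T : Set V} {v x : V} (h : ∀ α ∈ T, ⟪v, α⟫_ℝ ≤ 0)
    (hx : x ∈ AddSubmonoid.closure T) : ⟪v, x⟫_ℝ ≤ 0 := by
  have := inner_nonneg_of_mem_closure (v := -v) (fun α hα => by
    rw [inner_neg_left]; linarith [h α hα]) hx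
  rw [inner_neg_left] at this
  linarith

lemma exists_nsmul_add_of_mem_closure {M : Type*} [AddCommMonoid M] {T : Set M} {α x : M}
    (hx : x ∈ AddSubmonoid.closure T) :
    ∃ k : ℕ, ∃ y ∈ AddSubmonoid.closure (T \ {α}), x = k • α + y := by
  have : T ⊆ {α} ∪ (T \ {α}) := by simp
  have hx' := AddSubmonoid.closure_mono this hx
  rw [AddSubmonoid.closure_union, AddSubmonoid.mem_sup] at hx'
  obtain ⟨z, hz, y, hy, rfl⟩ := hx'
  obtain ⟨k, rfl⟩ := AddSubmonoid.mem_closure_singleton.1 hz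
  exact ⟨k, y, hy, rfl⟩

/-- A simple reflection permutes the other positive roots. -/
lemma reflectRoot_pos {α β : V} (hα : α ∈ R.Simple) (hβ : β ∈ R.Pos) (hne : β ≠ α) :
    reflectRoot α β ∈ R.Pos := by
  have hαΔ := R.pos_subset hα.1
  have haa := R.inner_self_pos_of_mem hαΔ
  have hmem : reflectRoot α β ∈ R.Δ := R.reflect_mem β (R.pos_subset hβ) α hαΔ
  refine (R.mem_or_neg _ hmem).resolve_right fun hneg => ?_
  obtain ⟨n, hn⟩ := R.crystal β (R.pos_subset hβ) α hαΔ
  obtain ⟨k, b, hb, hkb⟩ :=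
    exists_nsmul_add_of_mem_closure (α := α) (R.pos_subset_closure_simple hβ)
  obtain ⟨l, c, hc, hlc⟩ :=
    exists_nsmul_add_of_mem_closure (α := α) (R.pos_subset_closure_simple hneg)
  have hbc : b + c = ((n - k - l : ℤ) : ℝ) • α := by
    have e : -reflectRoot α β = (n : ℝ) • α - β := by
      rw [reflectRoot, hn, mul_div_cancel_right₀ _ haa.ne']
      abel
    have e2 : l • α + c = (n : ℝ) • α - (k • α + b) := by rw [← hlc, ← hkb, e]
    rw [← Nat.cast_smul_eq_nsmul ℝ, ← Nat.cast_smul_eq_nsmul ℝ] at e2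
    push_cast
    linear_combination (norm := module) e2
  have hsub : R.Simple \ {α} ⊆ R.Simple := Set.sdiff_subset
  have hm : n - k - l ≤ 0 := by
    have h1 : ⟪α, b + c⟫_ℝ ≤ 0 := inner_nonpos_of_mem_closure
      (fun γ hγ => R.inner_simple_nonpos hα hγ.1 (Ne.symm hγ.2)) (add_mem hb hc)
    rw [hbc, inner_smul_right] at h1
    have : ((n - k - l : ℤ) : ℝ) ≤ 0 := by
      by_contra! h
      nlinarith [mul_pos h haa]
    exact_mod_cast this
  obtain ⟨p, hp⟩ := Int.eq_ofNat_of_zero_le (neg_nonneg.2 hm)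
  have hb0 : b = 0 := by
    refine R.eq_zero_of_mem_posCone (R.closure_le_posCone hsub hb) ?_
    have : -b = c + p • α := by
      rw [← Nat.cast_smul_eq_nsmul ℝ]
      have e : ((n - k - l : ℤ) : ℝ) = -(p : ℝ) := by
        have : n - k - l = -(p : ℤ) := by omega
        rw [this]; push_cast; rfl
      rw [e] at hbc
      linear_combination (norm := module) -hbc
    rw [this]
    exact add_mem (R.closure_le_posCone hsub hc)
      (AddSubmonoid.nsmul_mem _ (R.mem_posCone_of_pos hα.1) _)
  rw [hb0, add_zero, ← Nat.cast_smul_eq_nsmul ℝ] at hkb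
  rcases R.reduced α hαΔ k (hkb ▸ R.pos_subset hβ) with h | h
  · exact hne (by rw [hkb, h, one_smul])
  · have : (0 : ℝ) ≤ k := Nat.cast_nonneg k
    linarith

/-- The sum of the positive roots pairs positively with every simple root. -/
lemma exists_inner_simple_pos : ∃ v : V, ∀ α ∈ R.Simple, 0 < ⟪v, α⟫_ℝ := by
  classical
  have hfin : R.Pos.Finite := R.finite.subset R.pos_subset
  refine ⟨∑ β ∈ hfin.toFinset, β, fun α hα => ?_⟩
  have haa := R.inner_self_pos_of_mem (R.pos_subset hα.1)
  have hrefl : ∀ β, ⟪reflectRoot α β, α⟫_ℝ = -⟪β, α⟫_ℝ := fun β => by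
    rw [reflectRoot, inner_sub_left, real_inner_smul_left]
    field_simp
    ring
  have hinv : ∀ β, reflectRoot α (reflectRoot α β) = β := fun β => by
    have := hrefl β
    rw [reflectRoot, this, reflectRoot]
    module
  rw [sum_inner, ← Finset.add_sum_erase _ _ (hfin.mem_toFinset.2 hα.1)]
  rw [Finset.sum_involution (fun β _ => reflectRoot α β)]
  · simpa using haa
  · intro β _
    rw [hrefl]; ring
  · intro β _ hβ h
    apply hβ
    have := hrefl β
    rw [h] at this
    linarith
  · intro β hβ
    rw [Finset.mem_erase, hfin.mem_toFinset] at hβ ⊢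
    refine ⟨fun h => ?_, R.reflectRoot_pos hα hβ.2 hβ.1⟩
    have h' := hinv β
    rw [h, reflectRoot, mul_div_cancel_right₀ _ haa.ne'] at h'
    refine R.not_neg_mem α hα.1 ?_
    rw [show -α = β by rw [← h']; module]
    exact hβ.2
  · intro β _
    exact hinv β

lemma linearIndepOn_simple : LinearIndepOn ℝ id R.Simple := by
  obtain ⟨v, hv⟩ := R.exists_inner_simple_pos
  refine LinearMap.BilinForm.linearIndependent_of_pairwise_le_zero (innerₗ V) ?_ (innerₗ V v)
    (fun i : R.Simple => id (i : V)) (fun i => hv i i.2) fun i j hij =>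
      R.inner_simple_nonpos i.2 j.2 (Subtype.coe_injective.ne hij)
  intro x hx
  simpa using real_inner_self_pos.2 hx

lemma simple_notMem_span {α : V} (hα : α ∈ R.Simple) :
    α ∉ Submodule.span ℝ (R.Simple \ {α}) := by
  refine (R.linearIndepOn_simple.mono Set.sdiff_subset).notMem_span_iff_id.2 ⟨?_, by simp⟩
  simpa [Set.insert_eq_of_mem hα] using R.linearIndepOn_simple

lemma closure_le_span {T : Set V} {x : V} (hx : x ∈ AddSubmonoid.closure T) :
    x ∈ Submodule.span ℝ T :=
  (AddSubmonoid.closure_le (S := (Submodule.span ℝ T).toAddSubmonoid)).2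
    Submodule.subset_span hx

lemma mem_closure_support {φ : V} (hφ : φ ∈ AddSubmonoid.closure R.Simple) :
    φ ∈ AddSubmonoid.closure (R.support φ) := by
  have hfin : R.Simple.Finite := R.finite.subset fun _ h => R.pos_subset h.1
  have key : ∀ F : Set V, F.Finite → F ⊆ R.Simple \ R.support φ →
      φ ∈ AddSubmonoid.closure (R.Simple \ F) := by
    intro F hF
    induction F, hF using Set.Finite.induction_on with
    | empty => simpa using hφ
    | @insert a F _ _ ih =>
      intro hsub
      obtain ⟨ha, hsub⟩ := Set.insert_subset_iff.1 hsub
      obtain ⟨k, y, hy, hky⟩ := exists_nsmul_add_of_mem_closure (α := a) (ih hsub)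
      have hset : (R.Simple \ F) \ {a} = R.Simple \ insert a F := by
        ext x; simp; tauto
      have hφa : φ ∈ Submodule.span ℝ (R.Simple \ {a}) := by
        by_contra h
        exact ha.2 ⟨ha.1, h⟩
      have hya : y ∈ Submodule.span ℝ (R.Simple \ {a}) :=
        Submodule.span_mono (Set.sdiff_subset_sdiff_left Set.sdiff_subset) (closure_le_span hy)
      have hk : k = 0 := by
        by_contra hk
        refine R.simple_notMem_span ha.1 ?_
        have hk' : (k : ℝ) ≠ 0 := by exact_mod_cast hk
        have : (k : ℝ) • a = φ - y := by rw [hky, Nat.cast_smul_eq_nsmul]; abel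
        exact (Submodule.smul_mem_iff _ hk').1 (this ▸ Submodule.sub_mem _ hφa hya)
      rw [hky, hk, zero_smul, zero_add, ← hset]
      exact hy
  have := key _ (hfin.subset Set.sdiff_subset) subset_rfl
  rwa [Set.sdiff_sdiff_cancel_left fun _ h => h.1] at this

lemma support_subset_of_mem_span {T : Set V} (hT : T ⊆ R.Simple) {φ : V}
    (hφ : φ ∈ Submodule.span ℝ T) : R.support φ ⊆ T := by
  intro α hα
  by_contra h
  have hsub : T ⊆ R.Simple \ {α} := fun x hx => ⟨hT hx, fun e => h (e ▸ hx)⟩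
  exact hα.2 (Submodule.span_mono hsub hφ)

/-- The roots lying in the span of `T`. -/
def levi (T : Set V) : Set V := {ψ ∈ R.Δ | ψ ∈ Submodule.span ℝ T}

lemma sub_eq_levi (φ : V) : R.sub φ = R.levi (R.support φ) := rfl

lemma support_subset (φ : V) : R.support φ ⊆ R.Simple := fun _ h => h.1

lemma levi_neg {T : Set V} {ψ : V} (h : ψ ∈ R.levi T) : -ψ ∈ R.levi T :=
  ⟨R.neg_mem _ h.1, Submodule.neg_mem _ h.2⟩

lemma levi_add {T : Set V} {φ ψ : V} (hφ : φ ∈ R.levi T) (hψ : ψ ∈ R.levi T)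
    (h : φ + ψ ∈ R.Δ) : φ + ψ ∈ R.levi T :=
  ⟨h, Submodule.add_mem _ hφ.2 hψ.2⟩

lemma mem_levi_of_mem {T : Set V} (hT : T ⊆ R.Simple) {α : V} (h : α ∈ T) : α ∈ R.levi T :=
  ⟨R.pos_subset (hT h).1, Submodule.subset_span h⟩

lemma mem_closure_of_mem_levi {T : Set V} (hT : T ⊆ R.Simple) {φ : V} (hφ : φ ∈ R.Pos)
    (h : φ ∈ R.levi T) : φ ∈ AddSubmonoid.closure T :=
  AddSubmonoid.closure_mono (R.support_subset_of_mem_span hT h.2)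
    (R.mem_closure_support (R.pos_subset_closure_simple hφ))

lemma levi_simple : R.levi R.Simple = R.Δ := by
  refine Set.Subset.antisymm (fun _ h => h.1) fun φ hφ => ⟨hφ, ?_⟩
  rcases R.mem_or_neg φ hφ with h | h
  · exact closure_le_span (R.pos_subset_closure_simple h)
  · exact (Submodule.neg_mem_iff _).1 (closure_le_span (R.pos_subset_closure_simple h))

/-- A set of roots closed under negation contained in the span of `T` can be tested on
positive roots. -/
lemma mem_span_of_pos_mem_span {S T : Set V} (hS : ∀ ψ ∈ S, -ψ ∈ S) (hΔ : S ⊆ R.Δ)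
    (h : ∀ ψ ∈ S, ψ ∈ R.Pos → ψ ∈ Submodule.span ℝ T) : S ⊆ R.levi T := by
  intro ψ hψ
  refine ⟨hΔ hψ, ?_⟩
  rcases R.mem_or_neg ψ (hΔ hψ) with hp | hp
  · exact h ψ hψ hp
  · exact (Submodule.neg_mem_iff _).1 (h _ (hS ψ hψ) hp)

lemma exists_eq_add_of_mem_support {T : Set V} (hT : T ⊆ R.Simple) {α φ : V}
    (hα : α ∈ R.support φ) (hφ : φ ∈ AddSubmonoid.closure T) :
    ∃ y ∈ AddSubmonoid.closure T, φ = α + y := by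
  have hαT := R.support_subset_of_mem_span hT (closure_le_span hφ) hα
  obtain ⟨k, y, hy, hky⟩ := exists_nsmul_add_of_mem_closure (α := α) hφ
  obtain _ | k := k
  · refine (hα.2 ?_).elim
    rw [hky, zero_smul, zero_add]
    exact Submodule.span_mono (Set.sdiff_subset_sdiff_left hT) (closure_le_span hy)
  · refine ⟨k • α + y, add_mem (AddSubmonoid.nsmul_mem _ (AddSubmonoid.subset_closure hαT) _)
      (AddSubmonoid.closure_mono Set.sdiff_subset hy), ?_⟩
    rw [hky, succ_nsmul]
    abel

lemma support_subset_support_add {x y : V} (hx : x ∈ R.Pos) (hy : y ∈ R.Pos) :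
    R.support x ⊆ R.support (x + y) := by
  intro α hα
  refine ⟨hα.1, fun hspan => ?_⟩
  obtain ⟨z, hz, hxz⟩ := R.exists_eq_add_of_mem_support subset_rfl hα
    (R.pos_subset_closure_simple hx)
  obtain ⟨k, w, hw, hkw⟩ := exists_nsmul_add_of_mem_closure (α := α)
    (add_mem hz (R.pos_subset_closure_simple hy))
  refine R.simple_notMem_span hα.1 ((Submodule.smul_mem_iff _
    (by positivity : (k + 1 : ℝ) ≠ 0)).1 ?_)
  have : (k + 1 : ℝ) • α = x + y - w := by
    have e : x + y = α + (z + y) := by rw [hxz]; abel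
    rw [e, hkw, add_smul, one_smul, Nat.cast_smul_eq_nsmul]
    abel
  exact this ▸ Submodule.sub_mem _ hspan (closure_le_span hw)

lemma sub_notMem_pos {T₁ T₂ : Set V} (h₁ : T₁ ⊆ R.Simple) (h₂ : T₂ ⊆ R.Simple)
    (horth : Submodule.span ℝ T₁ ⟂ Submodule.span ℝ T₂) {γ δ : V} (hδ : δ ∈ R.Pos)
    (hγT : γ ∈ Submodule.span ℝ T₁) (hδT : δ ∈ Submodule.span ℝ T₂) : γ - δ ∉ R.Pos := by
  intro h
  have hU : T₁ ∪ T₂ ⊆ R.Simple := Set.union_subset h₁ h₂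
  have hmem : γ - δ ∈ AddSubmonoid.closure (T₁ ∪ T₂) :=
    R.mem_closure_of_mem_levi hU h ⟨R.pos_subset h, Submodule.sub_mem _
      (Submodule.span_mono Set.subset_union_left hγT)
      (Submodule.span_mono Set.subset_union_right hδT)⟩
  rw [AddSubmonoid.closure_union, AddSubmonoid.mem_sup] at hmem
  obtain ⟨x, hx, y, hy, hxy⟩ := hmem
  have e : γ - x = y + δ := by rw [eq_sub_iff_add_eq] at hxy; rw [← hxy]; abel
  have h0 : y + δ = 0 := by
    have := Submodule.isOrtho_iff_inner_eq.1 horth (γ - x)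
      (Submodule.sub_mem _ hγT (closure_le_span hx)) (y + δ)
      (Submodule.add_mem _ (closure_le_span hy) hδT)
    rw [e] at this
    exact inner_self_eq_zero.1 this
  refine R.ne_zero_of_pos hδ (R.eq_zero_of_mem_posCone (R.mem_posCone_of_pos hδ) ?_)
  rw [← eq_neg_of_add_eq_zero_left h0]
  exact R.closure_le_posCone h₂ hy

lemma add_notMem_of_isOrtho {T₁ T₂ : Set V} (h₁ : T₁ ⊆ R.Simple) (h₂ : T₂ ⊆ R.Simple)
    (horth : Submodule.span ℝ T₁ ⟂ Submodule.span ℝ T₂) {γ δ : V} (hγ : γ ∈ R.Pos)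
    (hδ : δ ∈ R.Pos) (hγT : γ ∈ Submodule.span ℝ T₁) (hδT : δ ∈ Submodule.span ℝ T₂) :
    γ + δ ∉ R.Δ := by
  intro h
  have h0 := Submodule.isOrtho_iff_inner_eq.1 horth γ hγT δ hδT
  rw [← R.sub_mem_iff_add_mem (R.pos_subset hδ) h0] at h
  rcases R.mem_or_neg _ h with h | h
  · exact R.sub_notMem_pos h₁ h₂ horth hδ hγT hδT h
  · rw [neg_sub] at h
    exact R.sub_notMem_pos h₂ h₁ horth.symm hγ hδT hγT h

/-- A positive root supported on the union of two orthogonal sets of simple roots is supported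
on one of them. -/
lemma mem_span_or_mem_span {T₁ T₂ : Set V} (h₁ : T₁ ⊆ R.Simple) (h₂ : T₂ ⊆ R.Simple)
    (horth : Submodule.span ℝ T₁ ⟂ Submodule.span ℝ T₂) {φ : V} (hφ : φ ∈ R.Pos)
    (hφT : φ ∈ R.levi (T₁ ∪ T₂)) :
    φ ∈ Submodule.span ℝ T₁ ∨ φ ∈ Submodule.span ℝ T₂ := by
  have hU : T₁ ∪ T₂ ⊆ R.Simple := Set.union_subset h₁ h₂
  have hcl := R.mem_closure_of_mem_levi hU hφ hφT
  have hsub := R.support_subset_of_mem_span hU (closure_le_span hcl)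
  clear hφT hcl
  induction hk : R.rank φ using Nat.strong_induction_on generalizing φ with
  | _ k ih =>
  by_cases hs : φ ∈ R.Simple
  · have hself : φ ∈ R.support φ := ⟨hs, R.simple_notMem_span hs⟩
    exact (hsub hself).imp (fun h => Submodule.subset_span h) (fun h => Submodule.subset_span h)
  · obtain ⟨γ, hγ, δ, hδ, rfl⟩ : ∃ β ∈ R.Pos, ∃ γ ∈ R.Pos, φ = β + γ := by
      by_contra hcon
      exact hs ⟨hφ, hcon⟩
    have k1 : R.rank γ < k := hk ▸ R.rank_lt_rank (R.pos_subset hφ)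
      (by simpa using R.mem_posCone_of_pos hδ) (by simpa using R.ne_zero_of_pos hδ)
    have k2 : R.rank δ < k := hk ▸ R.rank_lt_rank (R.pos_subset hφ)
      (by simpa using R.mem_posCone_of_pos hγ) (by simpa using R.ne_zero_of_pos hγ)
    rcases ih _ k1 hγ ((R.support_subset_support_add hγ hδ).trans hsub) rfl with g | g <;>
      rcases ih _ k2 hδ ((add_comm δ γ ▸ R.support_subset_support_add hδ hγ).trans hsub) rfl
        with d | d
    · exact .inl (Submodule.add_mem _ g d)
    · exact (R.add_notMem_of_isOrtho h₁ h₂ horth hγ hδ g d (R.pos_subset hφ)).elim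
    · exact (R.add_notMem_of_isOrtho h₂ h₁ horth.symm hγ hδ g d (R.pos_subset hφ)).elim
    · exact .inr (Submodule.add_mem _ g d)

/-- An irreducible component of a standard subsystem is again a standard subsystem. -/
lemma component_eq_levi {T C : Set V} (hT : T ⊆ R.Simple) (hC : IsComponent (R.levi T) C) :
    C = R.levi (T ∩ C) := by
  obtain ⟨hCT, -, hort⟩ := hC
  have hneg : ∀ ψ ∈ C, -ψ ∈ C := by
    intro ψ hψ
    by_contra h
    have := hort ψ hψ _ ⟨R.levi_neg (hCT hψ), h⟩
    rw [inner_neg_right, neg_eq_zero] at this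
    exact R.ne_zero_of_mem (hCT hψ).1 (inner_self_eq_zero.1 this)
  have hzero : ∀ {v : V} {U : Set V}, (∀ u ∈ U, ⟪v, u⟫_ℝ = 0) → ∀ x ∈ Submodule.span ℝ U,
      ⟪v, x⟫_ℝ = 0 := by
    intro v U h x hx
    have := (Submodule.isOrtho_span (𝕜 := ℝ) (s := {v}) (t := U)).2 (by simpa using h)
    exact Submodule.isOrtho_iff_inner_eq.1 this v (Submodule.mem_span_singleton_self v) x hx
  apply Set.Subset.antisymm
  · refine R.mem_span_of_pos_mem_span hneg (fun _ h => (hCT h).1) fun φ hφ hpos => ?_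
    have hcl := R.mem_closure_of_mem_levi hT hpos (hCT hφ)
    rw [← Set.inter_union_sdiff T C, AddSubmonoid.closure_union, AddSubmonoid.mem_sup] at hcl
    obtain ⟨x, hx, y, hy, rfl⟩ := hcl
    have h1 : ⟪x + y, y⟫_ℝ = 0 := hzero (U := T \ C)
      (fun u hu => hort _ hφ u ⟨R.mem_levi_of_mem hT hu.1, hu.2⟩) y (closure_le_span hy)
    have h2 : ⟪y, x⟫_ℝ = 0 := by
      refine hzero (U := T ∩ C) (fun u hu => ?_) x (closure_le_span hx)
      rw [real_inner_comm]
      exact hzero (U := T \ C) (fun w hw => hort _ hu.2 w ⟨R.mem_levi_of_mem hT hw.1, hw.2⟩)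
        y (closure_le_span hy)
    rw [inner_add_left, real_inner_comm, h2, zero_add] at h1
    rw [inner_self_eq_zero.1 h1, add_zero]
    exact closure_le_span hx
  · intro φ hφ
    by_contra h
    have hφT : φ ∈ R.levi T := ⟨hφ.1, Submodule.span_mono Set.inter_subset_left hφ.2⟩
    have := hzero (v := φ) (U := T ∩ C)
      (fun u hu => by rw [real_inner_comm]; exact hort u hu.2 φ ⟨hφT, h⟩) φ hφ.2
    exact R.ne_zero_of_mem hφ.1 (inner_self_eq_zero.1 this)

/-- `β` is maximal in `S` with respect to the order defined by the cone of positive roots. -/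
def IsMaximal (S : Set V) (β : V) : Prop := β ∈ S ∧ ∀ ψ ∈ S, ψ - β ∈ R.posCone → ψ = β

lemma exists_isMaximal_above {S : Set V} (hS : S ⊆ R.Δ) {φ : V} (hφ : φ ∈ S) :
    ∃ β, R.IsMaximal S β ∧ β - φ ∈ R.posCone := by
  obtain ⟨β, ⟨hβ, hβφ⟩, hmax⟩ := Set.Finite.exists_maximalFor R.rank
    {χ ∈ S | χ - φ ∈ R.posCone} ((R.finite.subset hS).subset (Set.sep_subset _ _))
    ⟨φ, hφ, by simp⟩
  refine ⟨β, ⟨hβ, fun ψ hψ h => ?_⟩, hβφ⟩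
  by_contra hne
  have hlt := R.rank_lt_rank (hS hψ) h (Ne.symm hne)
  have hmem : ψ - φ ∈ R.posCone := by simpa using add_mem h hβφ
  exact absurd (hmax ⟨hψ, hmem⟩ hlt.le) (not_le.2 hlt)

lemma IsHighest.isMaximal {R : RootSystemData V} {S : Set V} {β : V} (h : R.IsHighest S β) :
    R.IsMaximal S β := by
  refine ⟨h.1, fun ψ hψ h' => sub_eq_zero.1 (R.eq_zero_of_mem_posCone h' ?_)⟩
  rw [neg_sub]
  exact R.nonnegComb_iff_mem_posCone.1 (h.2.2 ψ hψ)

variable {R}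

lemma IsMaximal.pos {T : Set V} {β : V} (h : R.IsMaximal (R.levi T) β) : β ∈ R.Pos := by
  refine (R.mem_or_neg β h.1.1).resolve_right fun hn => ?_
  have := h.2 _ (R.levi_neg h.1) (by
    rw [sub_eq_add_neg]
    exact add_mem (R.mem_posCone_of_pos hn) (R.mem_posCone_of_pos hn))
  have h2 : (2 : ℝ) • β = 0 := by
    rw [two_smul]
    nth_rewrite 1 [← this]
    exact neg_add_cancel β
  exact R.ne_zero_of_mem h.1.1 ((smul_eq_zero.1 h2).resolve_left two_ne_zero)

lemma IsMaximal.inner_nonneg {T : Set V} {β : V} (h : R.IsMaximal (R.levi T) β) {α : V}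
    (hα : α ∈ R.Pos) (hαT : α ∈ R.levi T) : 0 ≤ ⟪β, α⟫_ℝ := by
  by_contra! hneg
  have hadd := R.add_mem_of_inner_neg h.1.1 (R.pos_subset hα)
    (fun e => R.not_neg_mem α hα (e ▸ h.pos)) hneg
  have := h.2 _ (R.levi_add h.1 hαT hadd) (by simpa using R.mem_posCone_of_pos hα)
  exact R.ne_zero_of_pos hα (by simpa using this)

lemma IsMaximal.support_eq {T : Set V} (hT : T ⊆ R.Simple) (hirr : IsIrred (R.levi T)) {β : V}
    (h : R.IsMaximal (R.levi T) β) : R.support β = T := by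
  have hsub : R.support β ⊆ T := R.support_subset_of_mem_span hT h.1.2
  refine hsub.antisymm fun α hαT => ?_
  by_contra hα
  have hβ := R.mem_closure_support (R.pos_subset_closure_simple h.pos)
  have horth : Submodule.span ℝ (R.support β) ⟂ Submodule.span ℝ (T \ R.support β) := by
    refine Submodule.isOrtho_span.2 fun {a} ha {b} hb => ?_
    refine le_antisymm (R.inner_simple_nonpos (hT (hsub ha)) (hT hb.1) ?_) ?_
    · rintro rfl; exact hb.2 ha
    · obtain ⟨y, hy, hay⟩ := R.exists_eq_add_of_mem_support (R.support_subset β) ha hβ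
      have h1 := h.inner_nonneg (hT hb.1).1 (R.mem_levi_of_mem hT hb.1)
      have h2 : ⟪b, y⟫_ℝ ≤ 0 := inner_nonpos_of_mem_closure (fun c hc =>
        R.inner_simple_nonpos (hT hb.1) hc.1 fun e => hb.2 (e ▸ hc)) hy
      rw [hay, inner_add_left] at h1
      linarith [real_inner_comm y b]
  have hself : ∀ {x : V}, x ∈ R.Δ → x ∈ Submodule.span ℝ (R.support β) →
      x ∉ Submodule.span ℝ (T \ R.support β) := fun hx h₁ h₂ =>
    R.ne_zero_of_mem hx (inner_self_eq_zero.1 (Submodule.isOrtho_iff_inner_eq.1 horth _ h₁ _ h₂))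
  refine hirr.2 ⟨R.levi (R.support β), R.levi (T \ R.support β), ?_, ?_, ⟨β, h.1.1,
    closure_le_span hβ⟩, ⟨α, R.pos_subset (hT hαT).1, Submodule.subset_span ⟨hαT, hα⟩⟩,
    fun a ha b hb => Submodule.isOrtho_iff_inner_eq.1 horth a ha.2 b hb.2⟩
  · refine Set.Subset.antisymm (Set.union_subset
      (fun x hx => ⟨hx.1, Submodule.span_mono hsub hx.2⟩)
      (fun x hx => ⟨hx.1, Submodule.span_mono Set.sdiff_subset hx.2⟩)) fun x hx => ?_
    have key : ∀ z ∈ R.Pos, z ∈ R.levi T → z ∈ Submodule.span ℝ (R.support β) ∨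
        z ∈ Submodule.span ℝ (T \ R.support β) := fun z hz hzT =>
      R.mem_span_or_mem_span (R.support_subset β) (fun _ h => hT h.1) horth hz
        (by rwa [Set.union_sdiff_cancel hsub])
    rcases R.mem_or_neg x hx.1 with hp | hp
    · exact (key x hp hx).imp (⟨hx.1, ·⟩) (⟨hx.1, ·⟩)
    · exact (key _ hp (R.levi_neg hx)).imp (⟨hx.1, (Submodule.neg_mem_iff _).1 ·⟩)
        (⟨hx.1, (Submodule.neg_mem_iff _).1 ·⟩)
  · exact Set.eq_empty_of_forall_notMem fun x hx => hself hx.1.1 hx.1.2 hx.2.2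

/-- An irreducible standard subsystem has a unique maximal root. -/
lemma IsMaximal.unique {T : Set V} (hT : T ⊆ R.Simple) (hirr : IsIrred (R.levi T)) {β β' : V}
    (h : R.IsMaximal (R.levi T) β) (h' : R.IsMaximal (R.levi T) β') : β = β' := by
  by_contra hne
  have hdom : ∀ α ∈ T, 0 ≤ ⟪β, α⟫_ℝ := fun α hα =>
    h.inner_nonneg (hT hα).1 (R.mem_levi_of_mem hT hα)
  obtain ⟨α, hα, hαβ⟩ : ∃ α ∈ T, 0 < ⟪β, α⟫_ℝ := by
    by_contra! hcon
    have := inner_nonpos_of_mem_closure hcon (R.mem_closure_of_mem_levi hT h.pos h.1)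
    exact absurd (R.inner_self_pos_of_mem h.1.1) (not_lt.2 this)
  obtain ⟨y, hy, hay⟩ := R.exists_eq_add_of_mem_support hT (h'.support_eq hT hirr ▸ hα)
    (R.mem_closure_of_mem_levi hT h'.pos h'.1)
  have hpos : 0 < ⟪β, β'⟫_ℝ := by
    rw [hay, inner_add_right]
    exact add_pos_of_pos_of_nonneg hαβ (inner_nonneg_of_mem_closure hdom hy)
  rcases R.mem_or_neg _ (R.sub_mem_of_inner_pos h.1.1 h'.1.1 hne hpos) with hp | hp
  · exact hne (h'.2 β h.1 (R.mem_posCone_of_pos hp))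
  · rw [neg_sub] at hp
    exact hne (h.2 β' h'.1 (R.mem_posCone_of_pos hp)).symm

variable (R)

lemma exists_isHighest {T : Set V} (hT : T ⊆ R.Simple) (hirr : IsIrred (R.levi T)) :
    ∃ β, R.IsHighest (R.levi T) β := by
  obtain ⟨φ, hφ⟩ := hirr.1
  obtain ⟨β, hβ, -⟩ := R.exists_isMaximal_above (fun _ h => h.1) hφ
  refine ⟨β, hβ.1, hβ.pos, fun ψ hψ => ?_⟩
  obtain ⟨β', hβ', h⟩ := R.exists_isMaximal_above (fun _ h => h.1) hψ
  rw [R.nonnegComb_iff_mem_posCone, hβ.unique hT hirr hβ']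
  exact h

lemma exists_isHighest_of_isComponent {T C : Set V} (hT : T ⊆ R.Simple)
    (hC : IsComponent (R.levi T) C) : ∃ β, R.IsHighest C β := by
  have e := R.component_eq_levi hT hC
  have hirr := hC.2.1
  rw [e] at hirr ⊢
  exact R.exists_isHighest (Set.inter_subset_left.trans hT) hirr

lemma sub_eq_of_isHighest {T C : Set V} (hT : T ⊆ R.Simple)
    (hC : IsComponent (R.levi T) C) {β : V} (hβ : R.IsHighest C β) : R.sub β = C := by
  have e := R.component_eq_levi hT hC
  have hirr := hC.2.1
  rw [e] at hirr hβ
  rw [R.sub_eq_levi, hβ.isMaximal.support_eq (Set.inter_subset_left.trans hT) hirr, ← e]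

/-- For a locally high root `β`, the roots of `Δ(β)°` form a standard subsystem. -/
lemma orth_eq_levi {β : V} (hβ : R.LocallyHigh β) :
    R.orth β = R.levi {α ∈ R.support β | ⟪α, β⟫_ℝ = 0} := by
  have hmax : R.IsMaximal (R.levi (R.support β)) β := hβ.2.isMaximal
  have hS := R.support_subset β
  apply Set.Subset.antisymm
  · refine R.mem_span_of_pos_mem_span
      (fun ψ h => ⟨R.levi_neg h.1, by rw [inner_neg_left, h.2, neg_zero]⟩)
      (fun ψ h => h.1.1) fun ψ hψ hpos => ?_
    have hcl := R.mem_closure_of_mem_levi hS hpos hψ.1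
    refine Submodule.span_mono (fun α hα => ?_)
      (closure_le_span (R.mem_closure_support (R.pos_subset_closure_simple hpos)))
    have hαβ := R.support_subset_of_mem_span hS (closure_le_span hcl) hα
    obtain ⟨y, hy, hay⟩ := R.exists_eq_add_of_mem_support hS hα hcl
    have hdom : ∀ γ ∈ R.support β, 0 ≤ ⟪β, γ⟫_ℝ := fun γ hγ =>
      hmax.inner_nonneg hγ.1.1 (R.mem_levi_of_mem hS hγ)
    have h1 := hψ.2
    have h2 := inner_nonneg_of_mem_closure hdom hy
    have h3 := hdom α hαβ
    rw [real_inner_comm, hay, inner_add_right] at h1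
    exact ⟨hαβ, by rw [real_inner_comm]; linarith⟩
  · intro ψ hψ
    refine ⟨⟨hψ.1, Submodule.span_mono (Set.sep_subset _ _) hψ.2⟩, ?_⟩
    have : Submodule.span ℝ {α ∈ R.support β | ⟪α, β⟫_ℝ = 0} ⟂ Submodule.span ℝ {β} :=
      Submodule.isOrtho_span.2 fun {a} ha {b} hb => by
        rw [Set.mem_singleton_iff.1 hb]; exact ha.2
    exact Submodule.isOrtho_iff_inner_eq.1 this ψ hψ.2 β (Submodule.mem_span_singleton_self β)

/-- `δ` is the highest root of an irreducible component of `S`. -/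
def IsComponentHighest (S : Set V) (δ : V) : Prop := ∃ C, IsComponent S C ∧ R.IsHighest C δ

variable {R}

lemma IsComponentHighest.sub_subset {T : Set V} (hT : T ⊆ R.Simple) {δ : V}
    (h : R.IsComponentHighest (R.levi T) δ) : R.LocallyHigh δ ∧ R.sub δ ⊆ R.levi T := by
  obtain ⟨C, hC, hδ⟩ := h
  have e := R.sub_eq_of_isHighest hT hC hδ
  exact ⟨⟨hδ.2.1, e ▸ hδ⟩, e ▸ hC.1⟩

lemma StronglyOrth.symm {φ ψ : V} (h : R.StronglyOrth φ ψ) : R.StronglyOrth ψ φ :=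
  ⟨add_comm φ ψ ▸ h.1, fun h' => h.2 (by simpa using R.neg_mem _ h')⟩

lemma LocallyHigh.stronglyOrth {β φ : V} (hβ : R.LocallyHigh β) (hφ : φ ∈ R.orth β)
    (hpos : φ ∈ R.Pos) : R.StronglyOrth β φ := by
  have h : β + φ ∉ R.Δ := fun hadd => by
    have := R.nonnegComb_iff_mem_posCone.1 (hβ.2.2.2 _ (R.levi_add hβ.2.1 hφ.1 hadd))
    refine R.ne_zero_of_pos hpos (R.eq_zero_of_mem_posCone (R.mem_posCone_of_pos hpos) ?_)
    simpa using this
  exact ⟨h, (R.sub_mem_iff_add_mem hφ.1.1 (by rw [real_inner_comm]; exact hφ.2)).not.2 h⟩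

lemma stronglyOrth_of_isComponent {T C : Set V} (hC : IsComponent (R.levi T) C) {φ ψ : V}
    (hφ : φ ∈ C) (hψ : ψ ∈ R.levi T \ C) : R.StronglyOrth φ ψ := by
  have h0 := hC.2.2 φ hφ ψ hψ
  have h : φ + ψ ∉ R.Δ := fun hadd => by
    by_cases hm : φ + ψ ∈ C
    · have := hC.2.2 _ hm ψ hψ
      rw [inner_add_left, h0, zero_add] at this
      exact R.ne_zero_of_mem hψ.1.1 (inner_self_eq_zero.1 this)
    · have := hC.2.2 φ hφ _ ⟨R.levi_add (hC.1 hφ) hψ.1 hadd, hm⟩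
      rw [inner_add_right, h0, add_zero] at this
      exact R.ne_zero_of_mem (hC.1 hφ).1 (inner_self_eq_zero.1 this)
  exact ⟨h, (R.sub_mem_iff_add_mem hψ.1.1 h0).not.2 h⟩

end RootSystemData

lemma IsComponent.eq_of_mem {V : Type*} [NormedAddCommGroup V] [InnerProductSpace ℝ V]
    {S C D : Set V} (hC : IsComponent S C) (hD : IsComponent S D) {x : V} (hxC : x ∈ C)
    (hxD : x ∈ D) : C = D := by
  have key : ∀ {A B : Set V}, IsComponent S A → IsComponent S B → x ∈ A → x ∈ B → A ⊆ B := by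
    intro A B hA hB hxA hxB y hy
    by_contra hyB
    exact hA.2.1.2 ⟨A ∩ B, A \ B, Set.inter_union_sdiff A B, by ext; simp; tauto, ⟨x, hxA, hxB⟩,
      ⟨y, hy, hyB⟩, fun a ha b hb => hB.2.2 a ha.2 b ⟨hA.1 hb.1, hb.2⟩⟩
  exact (key hC hD hxC hxD).antisymm (key hD hC hxD hxC)

/-- Every nonzero element of a set of vectors lies in an irreducible component. -/
lemma exists_isComponent_mem {V : Type*} [NormedAddCommGroup V] [InnerProductSpace ℝ V]
    {S : Set V} {x : V} (hx : x ∈ S) : ∃ C, IsComponent S C ∧ x ∈ C := by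
  let r : V → V → Prop := fun a b => b ∈ S ∧ ⟪a, b⟫_ℝ ≠ 0
  have key : ∀ A B : Set V, A ∪ B = {y ∈ S | Relation.ReflTransGen r x y} → A ∩ B = ∅ →
      x ∈ A → B.Nonempty → (∀ a ∈ A, ∀ b ∈ B, ⟪a, b⟫_ℝ = 0) → False := by
    rintro A B hU hI hxA ⟨b, hb⟩ h
    have hall : ∀ y, Relation.ReflTransGen r x y → y ∈ A := by
      intro y hy
      induction hy with
      | refl => exact hxA
      | @tail y z hxy hyz ih =>
        have : z ∈ A ∪ B := hU ▸ ⟨hyz.1, hxy.tail hyz⟩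
        exact this.resolve_right fun hz => hyz.2 (h y ih z hz)
    have hb' : b ∈ {y ∈ S | Relation.ReflTransGen r x y} := hU ▸ Or.inr hb
    exact Set.notMem_empty b (hI ▸ ⟨hall b hb'.2, hb⟩)
  refine ⟨{y ∈ S | Relation.ReflTransGen r x y}, ⟨Set.sep_subset _ _,
    ⟨⟨x, hx, .refl⟩, ?_⟩, ?_⟩, hx, .refl⟩
  · rintro ⟨A, B, hU, hI, hA, hB, h⟩
    have hxU : x ∈ A ∪ B := hU ▸ ⟨hx, .refl⟩
    rcases hxU with hxA | hxB
    · exact key A B hU hI hxA hB h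
    · exact key B A (Set.union_comm B A ▸ hU) (Set.inter_comm B A ▸ hI) hxB hA
        fun a ha b hb => by rw [real_inner_comm]; exact h b hb a ha
  · rintro a ⟨-, ha⟩ b ⟨hbS, hb⟩
    by_contra hab
    exact hb ⟨hbS, ha.tail ⟨hbS, hab⟩⟩

namespace RootSystemData

variable {V : Type*} [NormedAddCommGroup V] [InnerProductSpace ℝ V] (R : RootSystemData V)

/-- `δ` may follow `γ` in a chain cascade. -/
def CascadeStep (γ δ : V) : Prop := R.IsComponentHighest (R.orth γ) δ

lemma mem_cascade_iff {β : V} :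
    β ∈ R.cascade ↔
      ∃ b, R.IsComponentHighest R.Δ b ∧ Relation.ReflTransGen R.CascadeStep b β := by
  constructor
  · rintro ⟨l, ⟨hne, hhead, hl⟩, hβ⟩
    obtain ⟨b, t, rfl⟩ := List.exists_cons_of_ne_nil hne
    refine ⟨b, hhead b (by simp), ?_⟩
    replace hl : List.IsChain R.CascadeStep (b :: t) := hl
    clear hne hhead
    induction t generalizing b with
    | nil =>
      rw [List.mem_singleton.1 hβ]
    | cons c t ih =>
      rw [List.isChain_cons_cons] at hl
      rcases List.mem_cons.1 hβ with rfl | hβ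
      · exact .refl
      · exact .head hl.1 (ih c hβ hl.2)
  · rintro ⟨b, hb, h⟩
    obtain ⟨l, hl, hlast⟩ := List.exists_isChain_cons_of_relationReflTransGen h
    refine ⟨b :: l, ⟨by simp, fun c hc => ?_, hl⟩, hlast ▸ List.getLast_mem _⟩
    obtain rfl : b = c := by simpa using hc
    exact hb

variable {R}

lemma orth_subset_sub (β : V) : R.orth β ⊆ R.sub β := fun _ h => h.1

lemma LocallyHigh.step {γ δ : V} (hγ : R.LocallyHigh γ) (h : R.CascadeStep γ δ) :
    R.LocallyHigh δ ∧ R.sub δ ⊆ R.orth γ := by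
  rw [CascadeStep, R.orth_eq_levi hγ] at h
  rw [R.orth_eq_levi hγ]
  exact h.sub_subset fun _ h => h.1.1

lemma LocallyHigh.reflTransGen {γ δ : V} (hγ : R.LocallyHigh γ)
    (h : Relation.ReflTransGen R.CascadeStep γ δ) : R.LocallyHigh δ ∧ R.sub δ ⊆ R.sub γ := by
  induction h with
  | refl => exact ⟨hγ, subset_rfl⟩
  | tail _ hstep ih =>
    have := ih.1.step hstep
    exact ⟨this.1, this.2.trans ((orth_subset_sub _).trans ih.2)⟩

/-- Descendants of a locally high root are strongly orthogonal to it. -/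
lemma LocallyHigh.stronglyOrth_descendant {γ δ β : V} (hγ : R.LocallyHigh γ)
    (h : R.CascadeStep γ δ) (hβ : Relation.ReflTransGen R.CascadeStep δ β) :
    R.StronglyOrth γ β := by
  have h1 := hγ.step h
  have h2 := h1.1.reflTransGen hβ
  exact hγ.stronglyOrth (h1.2 (h2.2 h2.1.2.1)) h2.1.1

/-- Descendants of distinct component highest roots are strongly orthogonal. -/
lemma IsComponentHighest.stronglyOrth {T : Set V} (hT : T ⊆ R.Simple) {b b' β β' : V}
    (hb : R.IsComponentHighest (R.levi T) b) (hb' : R.IsComponentHighest (R.levi T) b')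
    (hne : b ≠ b') (hβ : Relation.ReflTransGen R.CascadeStep b β)
    (hβ' : Relation.ReflTransGen R.CascadeStep b' β') : R.StronglyOrth β β' := by
  have h := (hb.sub_subset hT).1.reflTransGen hβ
  have h' := (hb'.sub_subset hT).1.reflTransGen hβ'
  obtain ⟨C, hC, hbC⟩ := hb
  obtain ⟨D, hD, hbD⟩ := hb'
  have hβC := h.2 h.1.2.1
  have hβD := h'.2 h'.1.2.1
  rw [R.sub_eq_of_isHighest hT hC hbC] at hβC
  rw [R.sub_eq_of_isHighest hT hD hbD] at hβD
  refine stronglyOrth_of_isComponent hC hβC ⟨hD.1 hβD, fun hβ'C => hne ?_⟩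
  obtain rfl := hC.eq_of_mem hD hβ'C hβD
  exact (hbD.isMaximal.2 _ hbC.1 (R.nonnegComb_iff_mem_posCone.1 (hbC.2.2 _ hbD.1)))

lemma LocallyHigh.stronglyOrth_of_descendants {γ β β' : V} (hγ : R.LocallyHigh γ)
    (hβ : Relation.ReflTransGen R.CascadeStep γ β)
    (hβ' : Relation.ReflTransGen R.CascadeStep γ β') (hne : β ≠ β') : R.StronglyOrth β β' := by
  induction hβ using Relation.ReflTransGen.head_induction_on with
  | refl =>
    rcases hβ'.cases_head with rfl | ⟨δ, hδ, hδβ'⟩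
    · exact (hne rfl).elim
    · exact hγ.stronglyOrth_descendant hδ hδβ'
  | @head γ δ hδ hδβ ih =>
    rcases hβ'.cases_head with rfl | ⟨δ', hδ', hδβ'⟩
    · exact (hγ.stronglyOrth_descendant hδ hδβ).symm
    · by_cases hdd : δ = δ'
      · subst hdd
        exact ih (hγ.step hδ).1 hδβ'
      · rw [CascadeStep, R.orth_eq_levi hγ] at hδ hδ'
        exact hδ.stronglyOrth (fun _ h => h.1.1) hδ' hdd hδβ hδβ'

lemma isComponentHighest_iff_levi {b : V} :
    R.IsComponentHighest R.Δ b ↔ R.IsComponentHighest (R.levi R.Simple) b := by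
  rw [R.levi_simple]

/-- Every positive root of a standard subsystem pairs positively with some descendant of a
component highest root. -/
lemma exists_inner_pos {T : Set V} (hT : T ⊆ R.Simple) {φ : V} (hφ : φ ∈ R.Pos)
    (hφT : φ ∈ R.levi T) :
    ∃ b β, R.IsComponentHighest (R.levi T) b ∧ Relation.ReflTransGen R.CascadeStep b β ∧
      0 < ⟪φ, β⟫_ℝ := by
  induction hk : (R.levi T).ncard using Nat.strong_induction_on generalizing T with
  | _ k ih =>
  obtain ⟨C, hC, hφC⟩ := exists_isComponent_mem hφT
  obtain ⟨b, hbC⟩ := R.exists_isHighest_of_isComponent hT hC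
  have hb : R.IsComponentHighest (R.levi T) b := ⟨C, hC, hbC⟩
  obtain ⟨hhigh, hsub⟩ := hb.sub_subset hT
  rw [← R.sub_eq_of_isHighest hT hC hbC] at hφC
  have hmax : R.IsMaximal (R.levi (R.support b)) b := hhigh.2.isMaximal
  rcases (hmax.inner_nonneg hφ hφC).lt_or_eq with h | h
  · exact ⟨b, b, hb, .refl, by rwa [real_inner_comm]⟩
  · have horth : φ ∈ R.orth b := ⟨hφC, by rw [real_inner_comm]; exact h.symm⟩
    have hlt : (R.orth b).ncard < k := by
      rw [← hk]
      refine Set.ncard_lt_ncard ⟨(orth_subset_sub b).trans hsub, fun hsub' => ?_⟩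
        (R.finite.subset fun _ h => h.1)
      exact (R.inner_self_pos_of_mem hmax.1.1).ne' (hsub' (hsub hmax.1)).2
    rw [R.orth_eq_levi hhigh] at hlt horth
    obtain ⟨d, β, hd, hdβ, hpos⟩ := ih _ hlt (fun _ h => h.1.1) horth rfl
    rw [← R.orth_eq_levi hhigh] at hd
    exact ⟨b, β, hb, .head hd hdβ, hpos⟩

end RootSystemData

/-- The cascade `ℬ` is a maximal set of pairwise strongly orthogonal roots
in `Δ₊`. -/
theorem statement6 {V : Type*} [NormedAddCommGroup V] [InnerProductSpace ℝ V]
    (R : RootSystemData V) :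
    R.cascade ⊆ R.Pos ∧
    (∀ β ∈ R.cascade, ∀ β' ∈ R.cascade, β ≠ β' → R.StronglyOrth β β') ∧
    (∀ S : Set V, S ⊆ R.Pos → (∀ a ∈ S, ∀ b ∈ S, a ≠ b → R.StronglyOrth a b) →
      R.cascade ⊆ S → S = R.cascade) := by
  refine ⟨fun β hβ => ?_, fun β hβ β' hβ' hne => ?_, fun S hS hSO hsub => ?_⟩
  · obtain ⟨b, hb, hbβ⟩ := R.mem_cascade_iff.1 hβ
    rw [RootSystemData.isComponentHighest_iff_levi] at hb
    exact ((hb.sub_subset subset_rfl).1.reflTransGen hbβ).1.1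
  · obtain ⟨b, hb, hbβ⟩ := R.mem_cascade_iff.1 hβ
    obtain ⟨b', hb', hbβ'⟩ := R.mem_cascade_iff.1 hβ'
    rw [RootSystemData.isComponentHighest_iff_levi] at hb hb'
    by_cases hbb : b = b'
    · subst hbb
      exact (hb.sub_subset subset_rfl).1.stronglyOrth_of_descendants hbβ hbβ' hne
    · exact hb.stronglyOrth subset_rfl hb' hbb hbβ hbβ'
  · refine Set.Subset.antisymm (fun φ hφ => ?_) hsub
    obtain ⟨b, β, hb, hbβ, hpos⟩ := RootSystemData.exists_inner_pos subset_rfl (hS hφ)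
      (R.levi_simple.symm ▸ R.pos_subset (hS hφ))
    rw [← RootSystemData.isComponentHighest_iff_levi] at hb
    have hβ : β ∈ R.cascade := R.mem_cascade_iff.2 ⟨b, hb, hbβ⟩
    by_contra hcon
    have hne : φ ≠ β := fun e => hcon (e ▸ hβ)
    exact (hSO φ hφ β (hsub hβ) hne).2 (R.sub_mem_of_inner_pos (R.pos_subset (hS hφ))
      (R.pos_subset (hS (hsub hβ))) hne hpos)
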